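/- Let $n\ge 1$ and let $\Omega\subset\mathbb{R}^n$ be a nonempty bounded open set with smooth boundary (near each boundary point, $\Omega$ is the set $\{\varphi<0\}$ for a $C^\infty$ function $\varphi$ with nonvanishing gradient there). For a continuous exponent $a:\overline\Omega\to(1,\infty)$, $L^{a(\cdot)}(\Omega)$ is the space of measurable $u$ with $\int_\Omega |u(x)|^{a(x)}\,dx<\infty$, and $$\|u\|_{L^{a(\cdot)}(\Omega)}=\inf\Big\{\lambda>0:\int_\Omega \Big|\frac{u(x)}{\lambda}\Big|^{a(x)}dx\le 1\Big\}.$$ Assume the following. - $p:\overline\Omega\to(1,\infty)$ is continuous, $2<p^-:=\min_{\overline\Omega}p\le p^+:=\max_{\overline\Omega}p<\infty$, and there is $M>0$ with $|p(x)-p(y)|\le M/\big|\log|x-y|\big|$ for all $x\neq y$ in $\Omega$ with $|x-y|<1/2$. - $q:\overline\Omega\times\overline\Omega\to(1,\infty)$ is continuous and symmetric, $1<q^-:=\min q\le q^+:=\max q<p^-$, and $q(x-z,y-z)=q(x,y)$ for all $x,y,z\in\Omega$ with $x-z,\,y-z\in\overline\Omega$. - $s:\mathbb{R}^n\times\mathbb{R}^n\to(0,1)$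 is continuous and symmetric; $s^-:=\min_{\overline\Omega\times\overline\Omega}s$. - $n>s^-q(x,y)$ for all $x,y\in\overline\Omega$, and $p(x)>q(x,x)$ for all $x\in\overline\Omega$. - $r:\overline\Omega\to(1,\infty)$ is continuous and $r(x)<q^*(x):=\dfrac{n\,q(x,x)}{n-s^-q(x,x)}$ for all $x\in\overline\Omega$. Let $$[u]_{q(\cdot),s(\cdot),\Omega}=\inf\Big\{\lambda>0:\int_\Omega\int_\Omega\Big|\frac{u(x)-u(y)}{\lambda}\Big|^{q(x,y)}\frac{dx\,dy}{|x-y|^{n+q(x,y)s(x,y)}}<1\Big\}$$ (with $\inf\emptyset=\infty$), and let $H_0^{s(\cdot)}(\Omega)$ be the set of Lebesgue measurable $u:\mathbb{R}^n\to\mathbb{R}$ with $u=0$ a.e. in $\mathbb{R}^n\setminus\Omega$, $u\in L^{p(\cdot)}(\Omega)$ and $[u]_{q(\cdot),s(\cdot),\Omega}<\infty$. Then there exists a constant $C=C(n,p,q,r,s,\Omega)>0$ such that every $v\in H_0^{s(\cdot)}(\Omega)$ belongs to $L^{r(\cdot)}(\Omega)$ and satisfies $$\|v\|_{L^{r(\cdot)}(\Omega)}\le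 C\big(\|v\|_{L^{p(\cdot)}(\Omega)}+[v]_{q(\cdot),s(\cdot),\Omega}\big);$$ that is, $H_0^{s(\cdot)}(\Omega)$ is continuously embedded into $L^{r(\cdot)}(\Omega)$. -/

import Mathlib

open MeasureTheory Set
open scoped ENNReal ContDiff

noncomputable section

/-- The set `Ω` has smooth boundary: near every boundary point it is the strict sublevel set
`{φ < 0}` of a smooth function `φ` whose derivative does not vanish at that point
(so that `∂Ω` is locally a smooth hypersurface and `Ω` lies locally on one side of it). -/
def HasSmoothBoundary {n : ℕ} (Ω : Set (EuclideanSpace ℝ (Fin n))) : Prop :=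
  ∀ x₀ ∈ frontier Ω, ∃ (U : Set (EuclideanSpace ℝ (Fin n))) (φ : EuclideanSpace ℝ (Fin n) → ℝ),
    IsOpen U ∧ x₀ ∈ U ∧ ContDiffOn ℝ ∞ φ U ∧ fderiv ℝ φ x₀ ≠ 0 ∧
      ∀ x ∈ U, (x ∈ Ω ↔ φ x < 0)

/-- The modular `ϱ_{a(·)}(u) = ∫_Ω |u(x)|^{a(x)} dx`, with values in `[0,∞]`. -/
def varModular {n : ℕ} (Ω : Set (EuclideanSpace ℝ (Fin n)))
    (a u : EuclideanSpace ℝ (Fin n) → ℝ) : ℝ≥0∞ :=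
  ∫⁻ x in Ω, ENNReal.ofReal (|u x| ^ a x)

/-- Membership in the variable-exponent Lebesgue space `L^{a(·)}(Ω)`
(`AEMeasurable` is Lebesgue measurability). -/
def MemVarLp {n : ℕ} (Ω : Set (EuclideanSpace ℝ (Fin n)))
    (a u : EuclideanSpace ℝ (Fin n) → ℝ) : Prop :=
  AEMeasurable u (volume.restrict Ω) ∧ varModular Ω a u < ⊤

/-- The Luxemburg norm `inf {l > 0 : ∫_Ω |u(x)/l|^{a(x)} dx ≤ 1}`, with values in `[0,∞]`
(it is `∞` if no such `l` exists). -/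
def luxNorm {n : ℕ} (Ω : Set (EuclideanSpace ℝ (Fin n)))
    (a u : EuclideanSpace ℝ (Fin n) → ℝ) : ℝ≥0∞ :=
  sInf (ENNReal.ofReal '' {l : ℝ | 0 < l ∧ varModular Ω a (fun x => u x / l) ≤ 1})

/-- The Gagliardo modular
`∫_Ω ∫_Ω |u(x) - u(y)|^{q(x,y)} |x - y|^{-(n + q(x,y) s(x,y))} dx dy`, with values in `[0,∞]`. -/
def gagliardoModular {n : ℕ} (Ω : Set (EuclideanSpace ℝ (Fin n)))
    (q s : EuclideanSpace ℝ (Fin n) → EuclideanSpace ℝ (Fin n) → ℝ)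
    (u : EuclideanSpace ℝ (Fin n) → ℝ) : ℝ≥0∞ :=
  ∫⁻ x in Ω, ∫⁻ y in Ω,
    ENNReal.ofReal (|u x - u y| ^ q x y / dist x y ^ ((n : ℝ) + q x y * s x y))

/-- The Gagliardo seminorm `[u]_{q(·),s(·),Ω}`, with values in `[0,∞]`. -/
def gagliardoSeminorm {n : ℕ} (Ω : Set (EuclideanSpace ℝ (Fin n)))
    (q s : EuclideanSpace ℝ (Fin n) → EuclideanSpace ℝ (Fin n) → ℝ)
    (u : EuclideanSpace ℝ (Fin n) → ℝ) : ℝ≥0∞ :=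
  sInf (ENNReal.ofReal '' {l : ℝ | 0 < l ∧ gagliardoModular Ω q s (fun x => u x / l) < 1})

/-- Membership in `H_0^{p(·),q(·),s(·)}(Ω)`: Lebesgue measurable functions on the whole space
that vanish almost everywhere outside `Ω`, belong to `L^{p(·)}(Ω)` and have finite
Gagliardo seminorm over `Ω`. -/
def MemH0 {n : ℕ} (Ω : Set (EuclideanSpace ℝ (Fin n)))
    (p : EuclideanSpace ℝ (Fin n) → ℝ)
    (q s : EuclideanSpace ℝ (Fin n) → EuclideanSpace ℝ (Fin n) → ℝ)
    (u : EuclideanSpace ℝ (Fin n) → ℝ) : Prop :=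
  AEMeasurable u volume ∧ (∀ᵐ x ∂volume, x ∉ Ω → u x = 0) ∧
    MemVarLp Ω p u ∧ gagliardoSeminorm Ω q s u < ⊤

end

/-- Near a boundary point of a set with smooth boundary, points of the set are vertices of interior
cones of uniform opening. -/
theorem HasSmoothBoundary.exists_local_interior_ball {n : ℕ} {Ω : Set (EuclideanSpace ℝ (Fin n))}
    (hΩo : IsOpen Ω) (hΩs : HasSmoothBoundary Ω) {x₀ : EuclideanSpace ℝ (Fin n)}
    (hx₀ : x₀ ∈ closure Ω) :
    ∃ κ > (0 : ℝ), ∃ η > (0 : ℝ), ∀ x ∈ Ω ∩ Metric.ball x₀ η, ∀ ρ, 0 < ρ → ρ ≤ η →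
      ∃ z, Metric.ball z (κ * ρ) ⊆ Ω ∩ Metric.ball x ρ := by
  by_cases hmem : x₀ ∈ Ω
  · obtain ⟨η, hη, hsub⟩ := Metric.isOpen_iff.1 hΩo x₀ hmem
    refine ⟨1, one_pos, η / 2, by positivity, fun x hx ρ hρ hρη => ⟨x, ?_⟩⟩
    rw [one_mul]
    refine subset_inter (fun y hy => hsub ?_) subset_rfl
    have h1 := Metric.mem_ball.1 hx.2
    have h2 := Metric.mem_ball.1 hy
    have h3 := dist_triangle y x x₀
    exact Metric.mem_ball.2 (by linarith)
  · have hfr : x₀ ∈ frontier Ω := by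
      rw [frontier, hΩo.interior_eq]
      exact ⟨hx₀, hmem⟩
    obtain ⟨U, φ, hUo, hxU, hφ, hd, hiff⟩ := hΩs x₀ hfr
    have hstrict : HasStrictFDerivAt φ (fderiv ℝ φ x₀) x₀ :=
      (hφ.contDiffAt (hUo.mem_nhds hxU)).hasStrictFDerivAt (by simp)
    set L := fderiv ℝ φ x₀ with hL
    obtain ⟨w, hw⟩ : ∃ w, L w ≠ 0 := by
      by_contra! h
      exact hd (ContinuousLinearMap.ext h)
    -- a unit vector along which `φ` decreases
    obtain ⟨e, he1, heL⟩ : ∃ e : EuclideanSpace ℝ (Fin n), ‖e‖ = 1 ∧ L e < 0 := by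
      have hw0 : w ≠ 0 := fun h => hw (by simp [h])
      have hwn : 0 < ‖w‖ := norm_pos_iff.2 hw0
      rcases lt_or_gt_of_ne hw with h | h
      · refine ⟨‖w‖⁻¹ • w, by simp [norm_smul, hwn.ne'], ?_⟩
        rw [map_smul, smul_eq_mul]
        exact mul_neg_of_pos_of_neg (by positivity) h
      · refine ⟨-(‖w‖⁻¹ • w), by simp [norm_smul, hwn.ne'], ?_⟩
        rw [map_neg, map_smul, smul_eq_mul]
        exact neg_neg_of_pos (by positivity)
    set m := -L e with hm
    have hmpos : 0 < m := by simp only [hm]; linarith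
    set κ : ℝ := min (1 / 4) (m / (8 * (‖L‖ + 1))) with hκ
    have hκpos : 0 < κ := by positivity
    have hκ4 : κ ≤ 1 / 4 := min_le_left _ _
    have hκL : ‖L‖ * κ ≤ m / 8 := by
      have h1 : κ ≤ m / (8 * (‖L‖ + 1)) := min_le_right _ _
      have h2 : 0 ≤ ‖L‖ := norm_nonneg _
      calc ‖L‖ * κ ≤ (‖L‖ + 1) * (m / (8 * (‖L‖ + 1))) := by gcongr; linarith
        _ = m / 8 := by field_simp
    have hev := hstrict.isLittleO.def (show (0 : ℝ) < m / 8 by positivity)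
    have hev2 : ∀ᶠ y in nhds (x₀, x₀), y.1 ∈ U ∧ y.2 ∈ U :=
       prod_mem_nhds (hUo.mem_nhds hxU) (hUo.mem_nhds hxU)
    obtain ⟨η, hη, hball⟩ := Metric.eventually_nhds_iff.1 (hev.and hev2)
    refine ⟨κ, hκpos, η / 2, by positivity, fun x hx ρ hρ hρη => ⟨x + (ρ / 2) • e, ?_⟩⟩
    intro y hy
    have hy' : ‖y - (x + (ρ / 2) • e)‖ < κ * ρ := by rwa [← dist_eq_norm]
    set d := y - (x + (ρ / 2) • e) with hdd
    have hyx : y - x = (ρ / 2) • e + d := by rw [hdd]; abel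
    have hnorm : ‖y - x‖ < ρ := by
      rw [hyx]
      calc ‖(ρ / 2) • e + d‖ ≤ ‖(ρ / 2) • e‖ + ‖d‖ := norm_add_le _ _
        _ < ρ / 2 + κ * ρ := by
            rw [norm_smul, he1, mul_one, Real.norm_of_nonneg (by positivity)]
            linarith
        _ ≤ ρ := by nlinarith
    have hxη : dist x x₀ < η / 2 := hx.2
    have hyη : dist y x₀ < η := by
      have := dist_triangle y x x₀
      rw [dist_eq_norm y x] at this
      linarith
    obtain ⟨hbd, hyU, hxU'⟩ := @hball (y, x) (by
      rw [Prod.dist_eq]; exact max_lt hyη (by simp only; linarith))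
    simp only at hbd hyU hxU'
    refine ⟨(hiff y hyU).2 ?_, by rw [Metric.mem_ball, dist_eq_norm]; exact hnorm⟩
    have hφx : φ x < 0 := (hiff x hxU').1 hx.1
    have h1 : φ y - φ x - L (y - x) ≤ m / 8 * ‖y - x‖ := (le_abs_self _).trans hbd
    have h2 : L (y - x) = -(ρ / 2 * m) + L d := by
      rw [hyx, map_add, map_smul, smul_eq_mul, hm]; ring
    have h3 : L d ≤ m / 8 * ρ := by
      calc L d ≤ ‖L d‖ := le_abs_self _
        _ ≤ ‖L‖ * ‖d‖ := L.le_opNorm d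
        _ ≤ ‖L‖ * (κ * ρ) := by gcongr
        _ = ‖L‖ * κ * ρ := by ring
        _ ≤ m / 8 * ρ := by gcongr
    have h4 : m / 8 * ‖y - x‖ ≤ m / 8 * ρ := by gcongr
    have h5 : 0 < m * ρ := by positivity
    linarith

/-- A bounded open set with smooth boundary satisfies the measure density condition. -/
theorem HasSmoothBoundary.exists_measure_density {n : ℕ} {Ω : Set (EuclideanSpace ℝ (Fin n))}
    (hΩo : IsOpen Ω) (hΩb : Bornology.IsBounded Ω) (hΩs : HasSmoothBoundary Ω) :
    ∃ c > (0 : ℝ), ∃ ρ₁ > (0 : ℝ), ∀ x ∈ Ω, ∀ ρ, 0 < ρ → ρ ≤ ρ₁ →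
      ENNReal.ofReal (c * ρ ^ n) ≤ volume (Ω ∩ Metric.ball x ρ) := by
  have hK : IsCompact (closure Ω) := hΩb.isCompact_closure
  obtain ⟨κ, hκ, η, hη, h⟩ : ∃ κ > (0 : ℝ), ∃ η > (0 : ℝ), ∀ x ∈ Ω ∩ closure Ω, ∀ ρ, 0 < ρ → ρ ≤ η →
      ∃ z, Metric.ball z (κ * ρ) ⊆ Ω ∩ Metric.ball x ρ := by
    refine hK.induction_on (p := fun S => ∃ κ > (0 : ℝ), ∃ η > (0 : ℝ), ∀ x ∈ Ω ∩ S, ∀ ρ, 0 < ρ →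
      ρ ≤ η → ∃ z, Metric.ball z (κ * ρ) ⊆ Ω ∩ Metric.ball x ρ) ?_ ?_ ?_ ?_
    · exact ⟨1, one_pos, 1, one_pos, by simp⟩
    · rintro S T hST ⟨κ, hκ, η, hη, h⟩
      exact ⟨κ, hκ, η, hη, fun x hx => h x ⟨hx.1, hST hx.2⟩⟩
    · rintro S T ⟨κ, hκ, η, hη, h⟩ ⟨κ', hκ', η', hη', h'⟩
      refine ⟨min κ κ', by positivity, min η η', by positivity, ?_⟩
      rintro x ⟨hxΩ, hx | hx⟩ ρ hρ hρη
      · obtain ⟨z, hz⟩ := h x ⟨hxΩ, hx⟩ ρ hρ (hρη.trans (min_le_left _ _))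
        exact ⟨z, (Metric.ball_subset_ball (by gcongr; exact min_le_left _ _)).trans hz⟩
      · obtain ⟨z, hz⟩ := h' x ⟨hxΩ, hx⟩ ρ hρ (hρη.trans (min_le_right _ _))
        exact ⟨z, (Metric.ball_subset_ball (by gcongr; exact min_le_right _ _)).trans hz⟩
    · intro x₀ hx₀
      obtain ⟨κ, hκ, η, hη, h⟩ := hΩs.exists_local_interior_ball hΩo hx₀
      exact ⟨Metric.ball x₀ η, mem_nhdsWithin_of_mem_nhds (Metric.ball_mem_nhds _ hη), κ, hκ, η, hη, h⟩
  set ν := volume (Metric.ball (0 : EuclideanSpace ℝ (Fin n)) 1) with hν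
  have hν0 : ν ≠ 0 := (Metric.measure_ball_pos volume _ one_pos).ne'
  have hνt : ν ≠ ⊤ := measure_ball_lt_top.ne
  refine ⟨κ ^ n * ν.toReal, mul_pos (by positivity) (ENNReal.toReal_pos hν0 hνt), η, hη, ?_⟩
  intro x hx ρ hρ hρη
  obtain ⟨z, hz⟩ := h x ⟨hx, subset_closure hx⟩ ρ hρ hρη
  refine le_trans (le_of_eq ?_) (measure_mono hz)
  rw [Measure.addHaar_ball_of_pos _ _ (by positivity), finrank_euclideanSpace_fin, ← hν,
    ← ENNReal.ofReal_toReal hνt, ← ENNReal.ofReal_mul (by positivity), ENNReal.toReal_ofReal (by positivity)]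
  congr 1
  ring

/-- If a constant is dominated on a set by `α + β g + γ k`, then it is dominated by the
corresponding bound for the averages. -/
theorem le_of_le_add_integral_bound {X : Type*} [MeasurableSpace X] {μ : Measure X} {E : Set X}
    (hE : MeasurableSet E) (hEt : μ E ≠ ⊤) {g k : X → ℝ} (hk : AEMeasurable k (μ.restrict E))
    {a α β γ G K m : ℝ} (hα : 0 ≤ α) (hβ : 0 ≤ β) (hγ : 0 ≤ γ) (hm : 0 < m) (hG : 0 ≤ G) (hK : 0 ≤ K)
    (hmE : ENNReal.ofReal m ≤ μ E)
    (hgG : ∫⁻ y in E, ENNReal.ofReal (g y) ∂μ ≤ ENNReal.ofReal G)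
    (hkK : ∫⁻ y in E, ENNReal.ofReal (k y) ∂μ ≤ ENNReal.ofReal K)
    (h : ∀ y ∈ E, a ≤ α + (β * g y + γ * k y)) :
    a ≤ α + (β * G + γ * K) / m := by
  have hμ : m ≤ (μ E).toReal := (ENNReal.ofReal_le_iff_le_toReal hEt).1 hmE
  have hμ0 : 0 < (μ E).toReal := hm.trans_le hμ
  have key : ENNReal.ofReal a * μ E ≤
      ENNReal.ofReal α * μ E + (ENNReal.ofReal (β * G) + ENNReal.ofReal (γ * K)) := by
    calc ENNReal.ofReal a * μ E = ∫⁻ _ in E, ENNReal.ofReal a ∂μ := by rw [setLIntegral_const]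
      _ ≤ ∫⁻ y in E, (ENNReal.ofReal α + (ENNReal.ofReal β * ENNReal.ofReal (g y) +
            ENNReal.ofReal γ * ENNReal.ofReal (k y))) ∂μ := by
          refine setLIntegral_mono' hE fun y hy => ?_
          refine (ENNReal.ofReal_le_ofReal (h y hy)).trans ?_
          rw [← ENNReal.ofReal_mul hβ, ← ENNReal.ofReal_mul hγ]
          refine ENNReal.ofReal_add_le.trans ?_
          gcongr
          exact ENNReal.ofReal_add_le
      _ = ENNReal.ofReal α * μ E + (ENNReal.ofReal β * ∫⁻ y in E, ENNReal.ofReal (g y) ∂μ +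
            ENNReal.ofReal γ * ∫⁻ y in E, ENNReal.ofReal (k y) ∂μ) := by
          rw [lintegral_add_left measurable_const, setLIntegral_const,
            lintegral_add_right' _ (hk.ennreal_ofReal.const_mul _),
            lintegral_const_mul' _ _ ENNReal.ofReal_ne_top,
            lintegral_const_mul' _ _ ENNReal.ofReal_ne_top]
      _ ≤ _ := by
          rw [ENNReal.ofReal_mul hβ, ENNReal.ofReal_mul hγ]
          gcongr
  have hreal : a * (μ E).toReal ≤ α * (μ E).toReal + (β * G + γ * K) := by
    rw [← ENNReal.ofReal_add (by positivity) (by positivity), ← ENNReal.ofReal_toReal hEt,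
      ← ENNReal.ofReal_mul' hμ0.le, ← ENNReal.ofReal_mul hα,
      ← ENNReal.ofReal_add (by positivity) (by positivity)] at key
    exact (ENNReal.ofReal_le_ofReal_iff (by positivity)).1 key
  have h1 : (β * G + γ * K) ≤ (β * G + γ * K) / m * (μ E).toReal := by
    rw [div_mul_eq_mul_div, le_div_iff₀ hm]
    gcongr
  have h2 : a * (μ E).toReal ≤ (α + (β * G + γ * K) / m) * (μ E).toReal := by
    rw [add_mul]; linarith
  exact le_of_mul_le_mul_right h2 hμ0

theorem rpow_le_one_add_rpow {w a b : ℝ} (hw : 0 ≤ w) (ha : 0 ≤ a) (hab : a ≤ b) :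
    w ^ a ≤ 1 + w ^ b := by
  rcases le_total w 1 with h | h
  · have := Real.rpow_le_one hw h ha
    have := Real.rpow_nonneg hw b
    linarith
  · have := Real.rpow_le_rpow_of_exponent_le h hab
    linarith

theorem le_mul_one_add_div_rpow {w t a : ℝ} (hw : 0 ≤ w) (ht : 0 < t) (ha : 1 ≤ a) :
    w ≤ t * (1 + (w / t) ^ a) := by
  have h := rpow_le_one_add_rpow (div_nonneg hw ht.le) zero_le_one ha
  rw [Real.rpow_one] at h
  calc w = t * (w / t) := by field_simp
    _ ≤ _ := by gcongr

/-- A difference is controlled by the Gagliardo integrand at scale `ρ`. -/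
theorem abs_sub_le_of_gagliardo_integrand {d δ ρ N Q q σ s H : ℝ} (hd : 0 ≤ d) (hδ : 0 ≤ δ)
    (hδρ : δ ≤ ρ) (hρ : 0 < ρ) (hρ1 : ρ ≤ 1) (hd0 : δ = 0 → d = 0) (hN : 0 ≤ N) (hQ : 1 ≤ Q)
    (hQq : Q ≤ q) (hσ : 0 < σ) (hσs : σ ≤ s) (hH : 1 ≤ H) :
    d ≤ H ^ (1 / Q) * ρ ^ σ * 2 +
      H ^ (1 / Q) * ρ ^ σ * ρ ^ N * H⁻¹ * (d ^ q / δ ^ (N + q * s)) := by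
  have hH0 : 0 < H := by linarith
  have hQ0 : 0 < Q := by linarith
  have hq0 : 0 < q := by linarith
  set T := H ^ (1 / Q) * ρ ^ σ with hT
  have hTpos : 0 < T := by positivity
  have hTQ : (d / T) ^ Q = H⁻¹ * (d / ρ ^ σ) ^ Q := by
    rw [hT, Real.div_rpow hd (by positivity), Real.mul_rpow (by positivity) (by positivity),
      ← Real.rpow_mul hH0.le, one_div_mul_cancel hQ0.ne', Real.rpow_one,
      Real.div_rpow hd (by positivity)]
    field_simp
  have hpow : (d / ρ ^ σ) ^ q ≤ ρ ^ N * (d ^ q / δ ^ (N + q * s)) := by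
    rcases hδ.eq_or_lt with h | h
    · rw [hd0 h.symm]
      simp [Real.zero_rpow hq0.ne']
    · rw [Real.div_rpow hd (by positivity), ← Real.rpow_mul hρ.le, mul_div_assoc',
        div_le_div_iff₀ (by positivity) (by positivity)]
      have h1 : δ ^ (N + q * s) ≤ ρ ^ (N + σ * q) := by
        calc δ ^ (N + q * s) ≤ ρ ^ (N + q * s) := by gcongr; nlinarith
          _ ≤ ρ ^ (N + σ * q) := Real.rpow_le_rpow_of_exponent_ge hρ hρ1 (by nlinarith)
      rw [Real.rpow_add hρ] at h1
      calc d ^ q * δ ^ (N + q * s) ≤ d ^ q * (ρ ^ N * ρ ^ (σ * q)) := by gcongr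
        _ = _ := by ring
  have h0 := le_mul_one_add_div_rpow hd hTpos hQ
  have h1 := rpow_le_one_add_rpow (show 0 ≤ d / ρ ^ σ by positivity) hQ0.le hQq
  have hHi : H⁻¹ ≤ 1 := inv_le_one_of_one_le₀ hH
  calc d ≤ T * (1 + H⁻¹ * (d / ρ ^ σ) ^ Q) := by rw [← hTQ]; exact h0
    _ ≤ T * (1 + H⁻¹ * (1 + ρ ^ N * (d ^ q / δ ^ (N + q * s)))) := by gcongr; linarith
    _ = T * (1 + H⁻¹) + T * ρ ^ N * H⁻¹ * (d ^ q / δ ^ (N + q * s)) := by ring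
    _ ≤ T * 2 + T * ρ ^ N * H⁻¹ * (d ^ q / δ ^ (N + q * s)) := by gcongr; linarith

/-- A value is controlled by its modular integrand at scale `ρ`. -/
theorem abs_le_of_modular_integrand {w ρ N b r A : ℝ} (hw : 0 ≤ w) (hρ : 0 < ρ)
    (hb : 1 ≤ b) (hbr : b ≤ r) (hA : 1 ≤ A) :
    w ≤ ρ ^ (-(N / b)) * A ^ (1 / b) +
      ρ ^ (-(N / b)) * A ^ (1 / b) * ρ ^ N * A⁻¹ * (1 + w ^ r) := by
  have hA0 : 0 < A := by linarith
  have hb0 : 0 < b := by linarith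
  set t := ρ ^ (-(N / b)) * A ^ (1 / b) with ht
  have htpos : 0 < t := by positivity
  have htb : (w / t) ^ b = ρ ^ N * A⁻¹ * w ^ b := by
    rw [ht, Real.div_rpow hw (by positivity), Real.mul_rpow (by positivity) (by positivity),
      ← Real.rpow_mul hA0.le, one_div_mul_cancel hb0.ne', Real.rpow_one, ← Real.rpow_mul hρ.le,
      neg_mul, div_mul_cancel₀ _ hb0.ne', Real.rpow_neg hρ.le]
    field_simp
  have h1 := rpow_le_one_add_rpow hw hb0.le hbr
  calc w ≤ t * (1 + ρ ^ N * A⁻¹ * w ^ b) := by rw [← htb]; exact le_mul_one_add_div_rpow hw htpos hb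
    _ ≤ t * (1 + ρ ^ N * A⁻¹ * (1 + w ^ r)) := by gcongr
    _ = _ := by ring

/-- Pointwise estimate at scale `ρ`: `|u(x)|` is bounded by the local Gagliardo energy and by the
local modular. -/
theorem abs_le_at_scale {n : ℕ} {Ω : Set (EuclideanSpace ℝ (Fin n))} (hΩo : IsOpen Ω)
    {u a : EuclideanSpace ℝ (Fin n) → ℝ} {q s : EuclideanSpace ℝ (Fin n) → EuclideanSpace ℝ (Fin n) → ℝ}
    (hmeas : AEMeasurable (fun y => |u y| ^ a y) (volume.restrict Ω))
    {x : EuclideanSpace ℝ (Fin n)} {c ρ Q b σ H A : ℝ} (hc : 0 < c) (hρ : 0 < ρ) (hρ1 : ρ ≤ 1)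
    (hdens : ENNReal.ofReal (c * ρ ^ n) ≤ volume (Ω ∩ Metric.ball x ρ))
    (hQ : 1 ≤ Q) (hb : 1 ≤ b) (hσ : 0 < σ) (hH : 1 ≤ H) (hA : 1 ≤ A)
    (hq : ∀ y ∈ Ω ∩ Metric.ball x ρ, Q ≤ q x y) (hs : ∀ y ∈ Ω ∩ Metric.ball x ρ, σ ≤ s x y)
    (ha : ∀ y ∈ Ω ∩ Metric.ball x ρ, b ≤ a y)
    (hG : ∫⁻ y in Ω, ENNReal.ofReal (|u x - u y| ^ q x y / dist x y ^ ((n : ℝ) + q x y * s x y)) ≤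
      ENNReal.ofReal (c * H))
    (hK : ∫⁻ y in Ω, ENNReal.ofReal (1 + |u y| ^ a y) ≤ ENNReal.ofReal A) :
    |u x| ≤ (3 + 1 / c) * (H ^ (1 / Q) * ρ ^ σ + ρ ^ (-((n : ℝ) / b)) * A ^ (1 / b)) := by
  set T := H ^ (1 / Q) * ρ ^ σ with hT
  set t := ρ ^ (-((n : ℝ) / b)) * A ^ (1 / b) with ht
  have hH0 : 0 < H := by linarith
  have hA0 : 0 < A := by linarith
  have hTpos : 0 < T := by positivity
  have htpos : 0 < t := by positivity
  have hE : MeasurableSet (Ω ∩ Metric.ball x ρ) := hΩo.measurableSet.inter measurableSet_ball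
  have hEt : volume (Ω ∩ Metric.ball x ρ) ≠ ⊤ :=
    ((measure_mono inter_subset_right).trans_lt measure_ball_lt_top).ne
  have hρn : ρ ^ (n : ℝ) = ρ ^ n := Real.rpow_natCast _ _
  have main := le_of_le_add_integral_bound (a := |u x|) (α := T * 2 + t)
    (β := T * ρ ^ (n : ℝ) * H⁻¹) (γ := t * ρ ^ (n : ℝ) * A⁻¹) (G := c * H) (K := A) (m := c * ρ ^ n)
    hE hEt ((hmeas.const_add 1).mono_measure (Measure.restrict_mono inter_subset_left le_rfl))
    (by positivity) (by positivity) (by positivity) (by positivity) (by positivity) hA0.le hdens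
    ((lintegral_mono_set inter_subset_left).trans hG)
    ((lintegral_mono_set inter_subset_left).trans hK) (by
      intro y hy
      have hyd : dist x y < ρ := by rw [dist_comm]; exact hy.2
      have h1 := abs_sub_le_of_gagliardo_integrand (d := |u x - u y|) (N := n) (abs_nonneg _)
        dist_nonneg hyd.le hρ hρ1 (fun h => by rw [dist_eq_zero.1 h]; simp) (Nat.cast_nonneg n) hQ
        (hq y hy) hσ (hs y hy) hH
      have h2 := abs_le_of_modular_integrand (N := n) (abs_nonneg (u y)) hρ hb (ha y hy) hA
      have h3 : |u x| ≤ |u x - u y| + |u y| := by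
        calc |u x| = |(u x - u y) + u y| := by ring_nf
          _ ≤ _ := abs_add_le _ _
      rw [← hT] at h1
      rw [← ht] at h2
      linarith)
  refine main.trans (le_of_eq_of_le (b := 3 * T + (1 + 1 / c) * t) ?_ ?_)
  · rw [hρn]; field_simp; ring
  · have : 0 < 1 / c := by positivity
    nlinarith [mul_pos this hTpos]

/-- Optimisation over the scale `ρ`. -/
theorem le_interpolation_of_forall_scale {w X Y ρ₀ b σ N C₀ C₁ : ℝ} (hX : 1 ≤ X) (hY : 1 ≤ Y)
    (hρ₀ : 0 < ρ₀) (hρ₀1 : ρ₀ ≤ 1) (hb : 1 ≤ b) (hσ : 0 < σ) (hN : 0 ≤ N) (hC₀ : 0 ≤ C₀)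
    (hC₁ : 0 ≤ C₁) (hwX : w ≤ C₁ * X)
    (hw : ∀ ρ, 0 < ρ → ρ ≤ ρ₀ → w ≤ C₀ * (X * ρ ^ σ + ρ ^ (-(N / b)) * Y)) :
    w ≤ (C₀ * (1 + ρ₀ ^ (-N)) + C₁) * (X ^ (N / (N + b * σ)) * Y ^ (b * σ / (N + b * σ))) := by
  have hX0 : 0 < X := by linarith
  have hY0 : 0 < Y := by linarith
  have hb0 : 0 < b := by linarith
  have hS : 0 < N + b * σ := by positivity
  set θ := N / (N + b * σ) with hθ
  set τ := b * σ / (N + b * σ) with hτ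
  have hsum : θ + τ = 1 := by rw [hθ, hτ]; field_simp
  have hτ0 : 0 ≤ τ := by positivity
  have hZ : 0 < X ^ θ * Y ^ τ := by positivity
  have hXX : X = X ^ θ * X ^ τ := by rw [← Real.rpow_add hX0, hsum, Real.rpow_one]
  have hYY : Y = Y ^ θ * Y ^ τ := by rw [← Real.rpow_add hY0, hsum, Real.rpow_one]
  rcases le_total X Y with h | h
  · calc w ≤ C₁ * X := hwX
      _ = C₁ * (X ^ θ * X ^ τ) := by rw [← hXX]
      _ ≤ C₁ * (X ^ θ * Y ^ τ) := by gcongr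
      _ ≤ _ := by
          have : 0 ≤ C₀ * (1 + ρ₀ ^ (-N)) := by positivity
          gcongr
          linarith
  · set κ := b / (N + b * σ) with hκ
    have hκ0 : 0 ≤ κ := by positivity
    have hYX : 0 < Y / X := by positivity
    have hYX1 : Y / X ≤ 1 := (div_le_one hX0).2 h
    have h1 := hw (ρ₀ * (Y / X) ^ κ) (by positivity)
      (mul_le_of_le_one_right hρ₀.le (Real.rpow_le_one hYX.le hYX1 hκ0))
    have e1 : κ * σ = τ := by rw [hκ, hτ]; ring
    have e2 : κ * (-(N / b)) = -θ := by rw [hκ, hθ]; field_simp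
    rw [Real.mul_rpow hρ₀.le (by positivity), Real.mul_rpow hρ₀.le (by positivity),
      ← Real.rpow_mul hYX.le, ← Real.rpow_mul hYX.le, e1, e2] at h1
    have a1 : X * (Y / X) ^ τ = X ^ θ * Y ^ τ := by
      rw [Real.div_rpow hY0.le hX0.le]
      nth_rewrite 1 [hXX]
      field_simp
    have a2 : (Y / X) ^ (-θ) * Y = X ^ θ * Y ^ τ := by
      rw [Real.rpow_neg hYX.le, Real.div_rpow hY0.le hX0.le]
      nth_rewrite 2 [hYY]
      field_simp
    have b1 : ρ₀ ^ σ ≤ 1 := Real.rpow_le_one hρ₀.le hρ₀1 hσ.le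
    have b2 : ρ₀ ^ (-(N / b)) ≤ ρ₀ ^ (-N) :=
      Real.rpow_le_rpow_of_exponent_ge hρ₀ hρ₀1 (neg_le_neg (div_le_self hN hb))
    calc w ≤ C₀ * (X * (ρ₀ ^ σ * (Y / X) ^ τ) + ρ₀ ^ (-(N / b)) * (Y / X) ^ (-θ) * Y) := h1
      _ = C₀ * (ρ₀ ^ σ * (X * (Y / X) ^ τ) + ρ₀ ^ (-(N / b)) * ((Y / X) ^ (-θ) * Y)) := by ring
      _ = C₀ * (ρ₀ ^ σ + ρ₀ ^ (-(N / b))) * (X ^ θ * Y ^ τ) := by rw [a1, a2]; ring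
      _ ≤ (C₀ * (1 + ρ₀ ^ (-N)) + C₁) * (X ^ θ * Y ^ τ) := by
          gcongr
          refine le_add_of_le_of_nonneg ?_ hC₁
          gcongr

theorem interpolation_rpow_le {H A Q b σ N r β D R : ℝ} (hH : 1 ≤ H) (hA : 1 ≤ A) (hQ : 1 ≤ Q)
    (hb : 1 ≤ b) (hσ : 0 < σ) (hN : 0 ≤ N) (hrR : r ≤ R) (hD : 1 ≤ D)
    (h1 : N * r ≤ Q * (N + b * σ)) (h2 : r * σ ≤ β * (N + b * σ)) :
    (D * ((H ^ (1 / Q)) ^ (N / (N + b * σ)) * (A ^ (1 / b)) ^ (b * σ / (N + b * σ)))) ^ r ≤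
      D ^ R * A ^ β * H := by
  have hH0 : 0 < H := by linarith
  have hA0 : 0 < A := by linarith
  have hb0 : 0 < b := by linarith
  have hQ0 : 0 < Q := by linarith
  have hS : 0 < N + b * σ := by positivity
  rw [Real.mul_rpow (by positivity) (by positivity), Real.mul_rpow (by positivity) (by positivity),
    ← Real.rpow_mul hH0.le, ← Real.rpow_mul hA0.le, ← Real.rpow_mul hH0.le, ← Real.rpow_mul hA0.le]
  have e1 : H ^ (1 / Q * (N / (N + b * σ)) * r) ≤ H := by
    calc _ ≤ H ^ (1 : ℝ) := by
          refine Real.rpow_le_rpow_of_exponent_le hH ?_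
          rw [show 1 / Q * (N / (N + b * σ)) * r = N * r / (Q * (N + b * σ)) by field_simp]
          exact (div_le_one (by positivity)).2 h1
      _ = H := Real.rpow_one H
  have e2 : A ^ (1 / b * (b * σ / (N + b * σ)) * r) ≤ A ^ β := by
    refine Real.rpow_le_rpow_of_exponent_le hA ?_
    rw [show 1 / b * (b * σ / (N + b * σ)) * r = r * σ / (N + b * σ) by field_simp]
    exact (div_le_iff₀ hS).2 h2
  have e3 : D ^ r ≤ D ^ R := Real.rpow_le_rpow_of_exponent_le hD hrR
  calc _ ≤ D ^ R * (H * A ^ β) := by gcongr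
    _ = _ := by ring

theorem le_rpow_of_le_mul_rpow {A K β : ℝ} (hA : 1 ≤ A) (hβ : β < 1)
    (h : A ≤ K * A ^ β) : A ≤ K ^ (1 / (1 - β)) := by
  have hA0 : 0 < A := by linarith
  have h1 : A ^ (1 - β) ≤ K := by
    rw [Real.rpow_sub hA0, Real.rpow_one, div_le_iff₀ (by positivity)]
    exact h
  have hβ' : 0 < 1 - β := by linarith
  calc A = (A ^ (1 - β)) ^ (1 / (1 - β)) := by
        rw [← Real.rpow_mul hA0.le, mul_one_div_cancel hβ'.ne', Real.rpow_one]
    _ ≤ K ^ (1 / (1 - β)) := by gcongr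

/-- Local comparison of exponents at scale `ρ₀`, in the form used for the subcritical embedding:
`Q x` and `b x` are lower bounds for `q x ·` and `r` near `x`, and `r` is strictly subcritical with
respect to them. -/
structure SubcriticalExponents {n : ℕ} (Ω : Set (EuclideanSpace ℝ (Fin n)))
    (r : EuclideanSpace ℝ (Fin n) → ℝ) (q : EuclideanSpace ℝ (Fin n) → EuclideanSpace ℝ (Fin n) → ℝ)
    (Q b : EuclideanSpace ℝ (Fin n) → ℝ) (σ β R ρ₀ : ℝ) : Prop where
  one_le_Q : ∀ x ∈ Ω, 1 ≤ Q x
  one_le_b : ∀ x ∈ Ω, 1 ≤ b x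
  Q_le : ∀ x ∈ Ω, ∀ y ∈ Ω, dist x y < ρ₀ → Q x ≤ q x y
  b_le : ∀ x ∈ Ω, ∀ y ∈ Ω, dist x y < ρ₀ → b x ≤ r y
  r_nonneg : ∀ x ∈ Ω, 0 ≤ r x
  r_le : ∀ x ∈ Ω, r x ≤ R
  subcritical : ∀ x ∈ Ω, (n : ℝ) * r x ≤ Q x * (n + b x * σ)
  sublinear : ∀ x ∈ Ω, r x * σ ≤ β * (n + b x * σ)
  β_nonneg : 0 ≤ β
  β_lt_one : β < 1

/-- The constant in the pointwise subcritical estimate. -/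
noncomputable def subcriticalConst (n : ℕ) (c ρ₀ V : ℝ) : ℝ :=
  (3 + 1 / c) * (1 + ρ₀ ^ (-(n : ℝ))) + (3 + 1 / c) * (1 + ρ₀ ^ (-(n : ℝ)) * (V + 1))

theorem one_le_subcriticalConst (n : ℕ) {c ρ₀ V : ℝ} (hc : 0 < c) (hρ₀ : 0 < ρ₀) (hV : 0 ≤ V) :
    1 ≤ subcriticalConst n c ρ₀ V := by
  have h1 : 0 < 1 / c := by positivity
  have h2 : 0 < ρ₀ ^ (-(n : ℝ)) := by positivity
  have h3 : 0 ≤ (3 + 1 / c) * (1 + ρ₀ ^ (-(n : ℝ)) * (V + 1)) := by positivity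
  unfold subcriticalConst
  nlinarith [mul_pos h1 h2]

/-- Pointwise subcritical estimate for functions of unit modular. -/
theorem rpow_abs_le_gagliardo_energy {n : ℕ} {Ω : Set (EuclideanSpace ℝ (Fin n))} (hΩo : IsOpen Ω)
    {u p r Q b : EuclideanSpace ℝ (Fin n) → ℝ}
    {q s : EuclideanSpace ℝ (Fin n) → EuclideanSpace ℝ (Fin n) → ℝ}
    {c σ β R ρ₀ V A : ℝ} (hexp : SubcriticalExponents Ω r q Q b σ β R ρ₀)
    (hum : AEMeasurable (fun y => |u y| ^ r y) (volume.restrict Ω))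
    (hupm : AEMeasurable (fun y => |u y| ^ p y) (volume.restrict Ω))
    (hc : 0 < c) (hσ : 0 < σ) (hρ₀ : 0 < ρ₀) (hρ₀1 : ρ₀ ≤ 1) (hV : 0 ≤ V)
    (hdens : ∀ x ∈ Ω, ∀ ρ, 0 < ρ → ρ ≤ ρ₀ →
      ENNReal.ofReal (c * ρ ^ n) ≤ volume (Ω ∩ Metric.ball x ρ))
    (hs : ∀ x ∈ Ω, ∀ y ∈ Ω, σ ≤ s x y) (hp : ∀ x ∈ Ω, 1 ≤ p x)
    (hup : ∫⁻ y in Ω, ENNReal.ofReal (1 + |u y| ^ p y) ≤ ENNReal.ofReal (V + 1))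
    (hA : 1 ≤ A) (hur : ∫⁻ y in Ω, ENNReal.ofReal (1 + |u y| ^ r y) ≤ ENNReal.ofReal A)
    {x : EuclideanSpace ℝ (Fin n)} (hx : x ∈ Ω) :
    ENNReal.ofReal (|u x| ^ r x) ≤ ENNReal.ofReal (subcriticalConst n c ρ₀ V ^ R * A ^ β) *
      (1 + ENNReal.ofReal (1 / c) * ∫⁻ y in Ω,
        ENNReal.ofReal (|u x - u y| ^ q x y / dist x y ^ ((n : ℝ) + q x y * s x y))) := by
  have hD := one_le_subcriticalConst n hc hρ₀ hV
  set D := subcriticalConst n c ρ₀ V with hDdef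
  set G := ∫⁻ y in Ω,
    ENNReal.ofReal (|u x - u y| ^ q x y / dist x y ^ ((n : ℝ) + q x y * s x y)) with hG
  have hc' : 0 < 1 / c := by positivity
  have hA0 : 0 < A := by linarith
  have hD0 : 0 < D := by linarith
  have hDA : 0 < D ^ R * A ^ β := by positivity
  by_cases hGt : G = ⊤
  · rw [hGt, ENNReal.mul_top (by simpa using hc), add_top,
      ENNReal.mul_top (by simpa using hDA)]
    exact le_top
  set H := 1 + 1 / c * G.toReal with hHdef
  have hH : 1 ≤ H := by
    have : 0 ≤ 1 / c * G.toReal := by positivity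
    linarith
  have hHeq : 1 + ENNReal.ofReal (1 / c) * G = ENNReal.ofReal H := by
    rw [hHdef, ENNReal.ofReal_add one_pos.le (by positivity), ENNReal.ofReal_mul hc'.le,
      ENNReal.ofReal_toReal hGt, ENNReal.ofReal_one]
  have hGH : G ≤ ENNReal.ofReal (c * H) := by
    rw [← ENNReal.ofReal_toReal hGt]
    refine ENNReal.ofReal_le_ofReal ?_
    rw [hHdef, mul_add, ← mul_assoc, mul_one_div_cancel hc.ne']
    linarith
  rw [hHeq, ← ENNReal.ofReal_mul hDA.le]
  refine ENNReal.ofReal_le_ofReal ?_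
  have hQx := hexp.one_le_Q x hx
  have hbx := hexp.one_le_b x hx
  have hQx0 : 0 < Q x := by linarith
  have hbx0 : 0 < b x := by linarith
  have hlt : ∀ {ρ : ℝ}, ρ ≤ ρ₀ → ∀ y ∈ Ω ∩ Metric.ball x ρ, dist x y < ρ₀ := fun hρ y hy => by
    rw [dist_comm]; exact lt_of_lt_of_le hy.2 hρ
  have hX : 1 ≤ H ^ (1 / Q x) := Real.one_le_rpow hH (by positivity)
  have hY : 1 ≤ A ^ (1 / b x) := Real.one_le_rpow hA (by positivity)
  have hcoarse : |u x| ≤ (3 + 1 / c) * (1 + ρ₀ ^ (-(n : ℝ)) * (V + 1)) * H ^ (1 / Q x) := by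
    have h := abs_le_at_scale (a := p) (b := 1) (A := V + 1) hΩo hupm hc hρ₀ hρ₀1
      (hdens x hx ρ₀ hρ₀ le_rfl) hQx le_rfl hσ hH (by linarith)
      (fun y hy => hexp.Q_le x hx y hy.1 (hlt le_rfl y hy)) (fun y hy => hs x hx y hy.1)
      (fun y hy => hp y hy.1) hGH hup
    simp only [div_one, Real.rpow_one] at h
    refine h.trans ?_
    rw [mul_assoc]
    gcongr
    have h1 : ρ₀ ^ σ ≤ 1 := Real.rpow_le_one hρ₀.le hρ₀1 hσ.le
    have h2 : 0 ≤ ρ₀ ^ (-(n : ℝ)) * (V + 1) := by positivity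
    rw [add_mul, one_mul]
    exact add_le_add (mul_le_of_le_one_right (by linarith) h1) (le_mul_of_one_le_right h2 hX)
  have hfine := le_interpolation_of_forall_scale (C₀ := 3 + 1 / c) hX hY hρ₀ hρ₀1 hbx hσ
    (Nat.cast_nonneg n) (by positivity) (by positivity) hcoarse
    (fun ρ hρ hρρ₀ => abs_le_at_scale hΩo hum hc hρ (hρρ₀.trans hρ₀1) (hdens x hx ρ hρ hρρ₀) hQx hbx
      hσ hH hA (fun y hy => hexp.Q_le x hx y hy.1 (hlt hρρ₀ y hy)) (fun y hy => hs x hx y hy.1)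
      (fun y hy => hexp.b_le x hx y hy.1 (hlt hρρ₀ y hy)) hGH hur)
  exact (Real.rpow_le_rpow (abs_nonneg _) hfine (hexp.r_nonneg x hx)).trans
    (interpolation_rpow_le hH hA hQx hbx hσ (Nat.cast_nonneg n)
      (hexp.r_le x hx) hD (hexp.subcritical x hx) (hexp.sublinear x hx))

theorem lintegral_one_add_rpow {n : ℕ} {Ω : Set (EuclideanSpace ℝ (Fin n))} {V : ℝ}
    (hV : volume Ω = ENNReal.ofReal V) (a u : EuclideanSpace ℝ (Fin n) → ℝ) :
    ∫⁻ y in Ω, ENNReal.ofReal (1 + |u y| ^ a y) = ENNReal.ofReal V + varModular Ω a u := by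
  have : ∀ y, ENNReal.ofReal (1 + |u y| ^ a y) = 1 + ENNReal.ofReal (|u y| ^ a y) := fun y => by
    rw [ENNReal.ofReal_add one_pos.le (by positivity), ENNReal.ofReal_one]
  simp only [this]
  rw [lintegral_add_left measurable_const, setLIntegral_const, one_mul, hV, varModular]

/-- The bound for the modular of subcritical functions of unit Gagliardo modular. -/
noncomputable def subcriticalModularBound (n : ℕ) (c ρ₀ V R β : ℝ) : ℝ :=
  (V + 1 + subcriticalConst n c ρ₀ V ^ R * (V + 1 / c)) ^ (1 / (1 - β))

/-- A priori estimate: the modular of exponent `r` is bounded as soon as it is finite. -/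
theorem varModular_le_of_lt_top {n : ℕ} {Ω : Set (EuclideanSpace ℝ (Fin n))} (hΩo : IsOpen Ω)
    {u p r Q b : EuclideanSpace ℝ (Fin n) → ℝ}
    {q s : EuclideanSpace ℝ (Fin n) → EuclideanSpace ℝ (Fin n) → ℝ}
    {c σ β R ρ₀ V : ℝ} (hexp : SubcriticalExponents Ω r q Q b σ β R ρ₀)
    (hum : AEMeasurable (fun y => |u y| ^ r y) (volume.restrict Ω))
    (hupm : AEMeasurable (fun y => |u y| ^ p y) (volume.restrict Ω))
    (hc : 0 < c) (hσ : 0 < σ) (hρ₀ : 0 < ρ₀) (hρ₀1 : ρ₀ ≤ 1) (hV : 0 ≤ V)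
    (hVΩ : volume Ω = ENNReal.ofReal V)
    (hdens : ∀ x ∈ Ω, ∀ ρ, 0 < ρ → ρ ≤ ρ₀ →
      ENNReal.ofReal (c * ρ ^ n) ≤ volume (Ω ∩ Metric.ball x ρ))
    (hs : ∀ x ∈ Ω, ∀ y ∈ Ω, σ ≤ s x y) (hp : ∀ x ∈ Ω, 1 ≤ p x)
    (hup : varModular Ω p u ≤ 1) (hug : gagliardoModular Ω q s u ≤ 1)
    (hur : varModular Ω r u < ⊤) :
    varModular Ω r u ≤ ENNReal.ofReal (subcriticalModularBound n c ρ₀ V R β) := by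
  have hD := one_le_subcriticalConst n hc hρ₀ hV
  set D := subcriticalConst n c ρ₀ V with hDdef
  have hD0 : 0 < D := by linarith
  have hc' : 0 < 1 / c := by positivity
  set I := (varModular Ω r u).toReal with hI
  have hI0 : 0 ≤ I := ENNReal.toReal_nonneg
  have hIeq : ENNReal.ofReal I = varModular Ω r u := ENNReal.ofReal_toReal hur.ne
  set A := V + 1 + I with hAdef
  have hA : 1 ≤ A := by linarith
  have hA0 : 0 < A := by linarith
  have hup' : ∫⁻ y in Ω, ENNReal.ofReal (1 + |u y| ^ p y) ≤ ENNReal.ofReal (V + 1) := by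
    rw [lintegral_one_add_rpow hVΩ, ENNReal.ofReal_add hV one_pos.le, ENNReal.ofReal_one]
    gcongr
  have hur' : ∫⁻ y in Ω, ENNReal.ofReal (1 + |u y| ^ r y) ≤ ENNReal.ofReal A := by
    rw [lintegral_one_add_rpow hVΩ, ← hIeq, ← ENNReal.ofReal_add hV hI0]
    exact ENNReal.ofReal_le_ofReal (by linarith)
  have key : varModular Ω r u ≤ ENNReal.ofReal (D ^ R * A ^ β * (V + 1 / c)) := by
    calc varModular Ω r u ≤ ∫⁻ x in Ω, ENNReal.ofReal (D ^ R * A ^ β) *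
          (1 + ENNReal.ofReal (1 / c) * ∫⁻ y in Ω,
            ENNReal.ofReal (|u x - u y| ^ q x y / dist x y ^ ((n : ℝ) + q x y * s x y))) :=
          setLIntegral_mono' hΩo.measurableSet fun x hx =>
            rpow_abs_le_gagliardo_energy hΩo hexp hum hupm hc hσ hρ₀ hρ₀1 hV hdens hs hp hup' hA
              hur' hx
      _ = ENNReal.ofReal (D ^ R * A ^ β) *
          (ENNReal.ofReal V + ENNReal.ofReal (1 / c) * gagliardoModular Ω q s u) := by
          rw [lintegral_const_mul' _ _ ENNReal.ofReal_ne_top, lintegral_add_left measurable_const,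
            setLIntegral_const, one_mul, hVΩ, lintegral_const_mul' _ _ ENNReal.ofReal_ne_top,
            gagliardoModular]
      _ ≤ ENNReal.ofReal (D ^ R * A ^ β) * (ENNReal.ofReal V + ENNReal.ofReal (1 / c) * 1) := by
          gcongr
      _ = _ := by
          rw [mul_one, ← ENNReal.ofReal_add hV hc'.le, ← ENNReal.ofReal_mul (by positivity)]
  rw [← hIeq] at key ⊢
  have hkey : I ≤ D ^ R * A ^ β * (V + 1 / c) :=
    (ENNReal.ofReal_le_ofReal_iff (by positivity)).1 key
  refine ENNReal.ofReal_le_ofReal (le_trans (show I ≤ A by linarith) ?_)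
  refine le_rpow_of_le_mul_rpow hA hexp.β_lt_one ?_
  have hAβ : 1 ≤ A ^ β := Real.one_le_rpow hA hexp.β_nonneg
  calc A = (V + 1) * 1 + I := by rw [hAdef]; ring
    _ ≤ (V + 1) * A ^ β + D ^ R * A ^ β * (V + 1 / c) := by gcongr
    _ = (V + 1 + D ^ R * (V + 1 / c)) * A ^ β := by ring

theorem varModular_mono {n : ℕ} {Ω : Set (EuclideanSpace ℝ (Fin n))} (hΩo : IsOpen Ω)
    {a u v : EuclideanSpace ℝ (Fin n) → ℝ} (ha : ∀ x ∈ Ω, 0 ≤ a x) (h : ∀ x, |u x| ≤ |v x|) :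
    varModular Ω a u ≤ varModular Ω a v :=
  setLIntegral_mono' hΩo.measurableSet fun x hx =>
    ENNReal.ofReal_le_ofReal (Real.rpow_le_rpow (abs_nonneg _) (h x) (ha x hx))

theorem gagliardoModular_mono {n : ℕ} {Ω : Set (EuclideanSpace ℝ (Fin n))} (hΩo : IsOpen Ω)
    {q s : EuclideanSpace ℝ (Fin n) → EuclideanSpace ℝ (Fin n) → ℝ}
    {u v : EuclideanSpace ℝ (Fin n) → ℝ} (hq : ∀ x ∈ Ω, ∀ y ∈ Ω, 0 ≤ q x y)
    (h : ∀ x y, |u x - u y| ≤ |v x - v y|) :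
    gagliardoModular Ω q s u ≤ gagliardoModular Ω q s v :=
  setLIntegral_mono' hΩo.measurableSet fun x hx =>
    setLIntegral_mono' hΩo.measurableSet fun y hy =>
      ENNReal.ofReal_le_ofReal (div_le_div_of_nonneg_right
        (Real.rpow_le_rpow (abs_nonneg _) (h x y) (hq x hx y hy)) (by positivity))

/-- Functions of unit modular and unit Gagliardo modular have bounded modular of any subcritical
exponent. -/
theorem varModular_le_subcriticalModularBound {n : ℕ} {Ω : Set (EuclideanSpace ℝ (Fin n))}
    (hΩo : IsOpen Ω) {u p r Q b : EuclideanSpace ℝ (Fin n) → ℝ}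
    {q s : EuclideanSpace ℝ (Fin n) → EuclideanSpace ℝ (Fin n) → ℝ}
    {c σ β R ρ₀ V : ℝ} (hexp : SubcriticalExponents Ω r q Q b σ β R ρ₀)
    (hu : AEMeasurable u (volume.restrict Ω)) (hpm : AEMeasurable p (volume.restrict Ω))
    (hrm : AEMeasurable r (volume.restrict Ω))
    (hc : 0 < c) (hσ : 0 < σ) (hρ₀ : 0 < ρ₀) (hρ₀1 : ρ₀ ≤ 1) (hV : 0 ≤ V)
    (hVΩ : volume Ω = ENNReal.ofReal V)
    (hdens : ∀ x ∈ Ω, ∀ ρ, 0 < ρ → ρ ≤ ρ₀ →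
      ENNReal.ofReal (c * ρ ^ n) ≤ volume (Ω ∩ Metric.ball x ρ))
    (hs : ∀ x ∈ Ω, ∀ y ∈ Ω, σ ≤ s x y) (hp : ∀ x ∈ Ω, 1 ≤ p x)
    (hq : ∀ x ∈ Ω, ∀ y ∈ Ω, 0 ≤ q x y)
    (hup : varModular Ω p u ≤ 1) (hug : gagliardoModular Ω q s u ≤ 1) :
    varModular Ω r u ≤ ENNReal.ofReal (subcriticalModularBound n c ρ₀ V R β) := by
  set f : ℕ → EuclideanSpace ℝ (Fin n) → ℝ := fun m x => min |u x| m with hf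
  have hf0 : ∀ m x, 0 ≤ f m x := fun m x => le_min (abs_nonneg _) (Nat.cast_nonneg m)
  have hfu : ∀ m x, |f m x| ≤ |u x| := fun m x => by
    rw [abs_of_nonneg (hf0 m x)]; exact min_le_left _ _
  have hfuu : ∀ m x y, |f m x - f m y| ≤ |u x - u y| := fun m x y =>
    (abs_min_sub_min_le_max _ _ _ _).trans (by simpa using abs_abs_sub_abs_le (u x) (u y))
  have hfm : ∀ m, AEMeasurable (f m) (volume.restrict Ω) := fun m =>
    (continuous_abs.measurable.comp_aemeasurable hu).min aemeasurable_const
  have habs : ∀ m, AEMeasurable (fun x => |f m x|) (volume.restrict Ω) := fun m =>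
    continuous_abs.measurable.comp_aemeasurable (hfm m)
  have hfin : ∀ m, varModular Ω r (f m) < ⊤ := fun m => by
    calc varModular Ω r (f m) ≤ ∫⁻ _ in Ω, ENNReal.ofReal (1 + (m : ℝ) ^ R) := by
          refine setLIntegral_mono' hΩo.measurableSet fun x hx => ENNReal.ofReal_le_ofReal ?_
          refine (rpow_le_one_add_rpow (abs_nonneg _) (hexp.r_nonneg x hx) (hexp.r_le x hx)).trans ?_
          have hR : 0 ≤ R := (hexp.r_nonneg x hx).trans (hexp.r_le x hx)
          gcongr
          rw [abs_of_nonneg (hf0 m x)]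
          exact min_le_right _ _
      _ < ⊤ := by
          rw [setLIntegral_const, hVΩ]
          exact ENNReal.mul_lt_top ENNReal.ofReal_lt_top ENNReal.ofReal_lt_top
  have hbd : ∀ m, varModular Ω r (f m) ≤ ENNReal.ofReal (subcriticalModularBound n c ρ₀ V R β) :=
    fun m => varModular_le_of_lt_top hΩo hexp ((habs m).pow hrm) ((habs m).pow hpm) hc hσ hρ₀ hρ₀1 hV
      hVΩ hdens hs hp
      ((varModular_mono hΩo (fun x hx => zero_le_one.trans (hp x hx)) (hfu m)).trans hup)
      ((gagliardoModular_mono hΩo hq (hfuu m)).trans hug) (hfin m)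
  have hlim : ∀ x, Filter.liminf (fun m => ENNReal.ofReal (|f m x| ^ r x)) Filter.atTop =
      ENNReal.ofReal (|u x| ^ r x) := fun x => by
    refine Filter.Tendsto.liminf_eq (tendsto_const_nhds.congr' ?_)
    obtain ⟨m₀, hm₀⟩ := exists_nat_ge |u x|
    filter_upwards [Filter.eventually_ge_atTop m₀] with m hm
    have : f m x = |u x| := min_eq_left (hm₀.trans (by exact_mod_cast hm))
    rw [this, abs_abs]
  calc varModular Ω r u
      = ∫⁻ x in Ω, Filter.liminf (fun m => ENNReal.ofReal (|f m x| ^ r x)) Filter.atTop := by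
        simp only [hlim, varModular]
    _ ≤ Filter.liminf (fun m => varModular Ω r (f m)) Filter.atTop :=
        lintegral_liminf_le' fun m => ((habs m).pow hrm).ennreal_ofReal
    _ ≤ Filter.liminf (fun _ : ℕ => ENNReal.ofReal (subcriticalModularBound n c ρ₀ V R β))
          Filter.atTop := Filter.liminf_le_liminf (Filter.Eventually.of_forall hbd)
    _ = _ := Filter.liminf_const _

theorem SubcriticalExponents.mono_scale {n : ℕ} {Ω : Set (EuclideanSpace ℝ (Fin n))}
    {r : EuclideanSpace ℝ (Fin n) → ℝ} {q : EuclideanSpace ℝ (Fin n) → EuclideanSpace ℝ (Fin n) → ℝ}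
    {Q b : EuclideanSpace ℝ (Fin n) → ℝ} {σ β R ρ₀ ρ₁ : ℝ}
    (h : SubcriticalExponents Ω r q Q b σ β R ρ₁) (hρ : ρ₀ ≤ ρ₁) :
    SubcriticalExponents Ω r q Q b σ β R ρ₀ :=
  { h with
    Q_le := fun x hx y hy hxy => h.Q_le x hx y hy (hxy.trans_le hρ)
    b_le := fun x hx y hy hxy => h.b_le x hx y hy (hxy.trans_le hρ) }

/-- Continuous exponents with `r < q*` on a compact closure are subcritical at small scales. -/
theorem exists_subcriticalExponents {n : ℕ} (hn : 1 ≤ n) {Ω : Set (EuclideanSpace ℝ (Fin n))}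
    (hne : Ω.Nonempty) (hK : IsCompact (closure Ω)) {r : EuclideanSpace ℝ (Fin n) → ℝ}
    {q : EuclideanSpace ℝ (Fin n) → EuclideanSpace ℝ (Fin n) → ℝ} {σ : ℝ} (hσ : 0 < σ)
    (hqc : ContinuousOn (Function.uncurry q) (closure Ω ×ˢ closure Ω))
    (hq1 : ∀ x ∈ closure Ω, 1 < q x x) (hnsq : ∀ x ∈ closure Ω, σ * q x x < n)
    (hrc : ContinuousOn r (closure Ω)) (hr1 : ∀ x ∈ closure Ω, 1 < r x)
    (hrsub : ∀ x ∈ closure Ω, r x < (n : ℝ) * q x x / ((n : ℝ) - σ * q x x)) :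
    ∃ (Q b : EuclideanSpace ℝ (Fin n) → ℝ) (β R ρ₀ : ℝ), 0 < ρ₀ ∧
      SubcriticalExponents Ω r q Q b σ β R ρ₀ := by
  have hneK : (closure Ω).Nonempty := hne.closure
  have hn0 : (0 : ℝ) < n := by exact_mod_cast hn
  have hdc : ContinuousOn (fun x => q x x) (closure Ω) :=
    hqc.comp (f := fun x => (x, x)) (by fun_prop) fun x hx => ⟨hx, hx⟩
  obtain ⟨x₁, hx₁, hR⟩ := hK.exists_isMaxOn hneK hrc
  obtain ⟨x₂, hx₂, hrmin⟩ := hK.exists_isMinOn hneK hrc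
  obtain ⟨x₃, hx₃, hqmin⟩ := hK.exists_isMinOn hneK hdc
  obtain ⟨x₄, hx₄, hqmax⟩ := hK.exists_isMaxOn hneK hdc
  have hFc : ContinuousOn (fun x => q x x * (n + r x * σ) - n * r x) (closure Ω) :=
    (hdc.mul (continuousOn_const.add (hrc.mul continuousOn_const))).sub (continuousOn_const.mul hrc)
  obtain ⟨x₅, hx₅, hFmin⟩ := hK.exists_isMinOn hneK hFc
  rw [isMaxOn_iff] at hR hqmax
  rw [isMinOn_iff] at hrmin hqmin hFmin
  set R := r x₁
  set S := q x₄ x₄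
  set F := q x₅ x₅ * (n + r x₅ * σ) - n * r x₅
  have hF : 0 < F := by
    have h1 := hrsub x₅ hx₅
    rw [lt_div_iff₀ (by linarith [hnsq x₅ hx₅])] at h1
    simp only [F]
    linarith
  have hR1 : 1 < R := hr1 x₁ hx₁
  have hS1 : 1 < S := hq1 x₄ hx₄
  have hr2 := hr1 x₂ hx₂
  have hq3 := hq1 x₃ hx₃
  set δ := min (min (r x₂ - 1) (q x₃ x₃ - 1)) (min (F / (n + R * σ + σ * S)) (n / (2 * σ)))
  have hden : 0 < n + R * σ + σ * S := by positivity
  have hδ : 0 < δ :=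
    lt_min (lt_min (by linarith) (by linarith)) (lt_min (by positivity) (by positivity))
  have hδ1 : δ ≤ r x₂ - 1 := (min_le_left _ _).trans (min_le_left _ _)
  have hδ2 : δ ≤ q x₃ x₃ - 1 := (min_le_left _ _).trans (min_le_right _ _)
  have hδ3 : δ * (n + R * σ + σ * S) ≤ F :=
    (le_div_iff₀ hden).1 ((min_le_right _ _).trans (min_le_left _ _))
  have hδ4 : δ * (2 * σ) ≤ n :=
    (le_div_iff₀ (by positivity)).1 ((min_le_right _ _).trans (min_le_right _ _))
  obtain ⟨ρ₁, hρ₁, hur⟩ :=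
    Metric.uniformContinuousOn_iff.1 (hK.uniformContinuousOn_of_continuous hrc) δ hδ
  obtain ⟨ρ₂, hρ₂, huq⟩ :=
    Metric.uniformContinuousOn_iff.1 ((hK.prod hK).uniformContinuousOn_of_continuous hqc) δ hδ
  refine ⟨fun x => q x x - δ, fun x => r x - δ, R * σ / (n / 2 + R * σ), R, min ρ₁ ρ₂, lt_min hρ₁ hρ₂,
    ⟨?_, ?_, ?_, ?_, ?_, ?_, ?_, ?_, by positivity, ?_⟩⟩
  · intro x hx
    linarith [hqmin x (subset_closure hx)]
  · intro x hx
    linarith [hrmin x (subset_closure hx)]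
  · intro x hx y hy hxy
    have hx' := subset_closure hx
    have hd : dist (x, x) (x, y) < ρ₂ := by
      simpa [Prod.dist_eq] using hxy.trans_le (min_le_right _ _)
    have h := huq (x, x) ⟨hx', hx'⟩ (x, y) ⟨hx', subset_closure hy⟩ hd
    rw [Real.dist_eq] at h
    have h' := (abs_lt.1 h).2
    simp only [Function.uncurry] at h'
    linarith
  · intro x hx y hy hxy
    have h := hur x (subset_closure hx) y (subset_closure hy) (hxy.trans_le (min_le_left _ _))
    rw [Real.dist_eq] at h
    linarith [(abs_lt.1 h).2]
  · intro x hx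
    linarith [hr1 x (subset_closure hx)]
  · intro x hx
    exact hR x (subset_closure hx)
  · intro x hx
    have hx' := subset_closure hx
    have h1 := hFmin x hx'
    have h2 := mul_le_mul_of_nonneg_left (hR x hx') (mul_pos hδ hσ).le
    have h3 := mul_le_mul_of_nonneg_left (hqmax x hx') (mul_pos hδ hσ).le
    have h4 : 0 < δ * δ * σ := by positivity
    change δ * σ * q x x ≤ δ * σ * S at h3
    change F ≤ q x x * (n + r x * σ) - n * r x at h1
    change δ * σ * r x ≤ δ * σ * R at h2
    linarith
  · intro x hx
    have hx' := subset_closure hx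
    have h1 : r x ≤ R := hR x hx'
    have h2 := hr1 x hx'
    rw [div_mul_eq_mul_div, le_div_iff₀ (by positivity)]
    have h3 : r x * σ ≤ R * σ := by gcongr
    have h4 : n / 2 + r x * σ ≤ n + (r x - δ) * σ := by linarith
    calc r x * σ * (n / 2 + R * σ) = r x * σ * (n / 2) + R * σ * (r x * σ) := by ring
      _ ≤ R * σ * (n / 2) + R * σ * (r x * σ) := by gcongr
      _ = R * σ * (n / 2 + r x * σ) := by ring
      _ ≤ R * σ * (n + (r x - δ) * σ) := by gcongr
  · rw [div_lt_one (by positivity)]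
    linarith

theorem varModular_div_le {n : ℕ} {Ω : Set (EuclideanSpace ℝ (Fin n))} (hΩo : IsOpen Ω)
    {a : EuclideanSpace ℝ (Fin n) → ℝ} (ha : ∀ x ∈ Ω, 1 ≤ a x) (u : EuclideanSpace ℝ (Fin n) → ℝ)
    {l : ℝ} (hl : 1 ≤ l) :
    varModular Ω a (fun x => u x / l) ≤ ENNReal.ofReal l⁻¹ * varModular Ω a u := by
  have hl0 : 0 < l := by linarith
  rw [varModular, varModular, ← lintegral_const_mul' _ _ ENNReal.ofReal_ne_top]
  refine setLIntegral_mono' hΩo.measurableSet fun x hx => ?_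
  rw [← ENNReal.ofReal_mul (by positivity)]
  refine ENNReal.ofReal_le_ofReal ?_
  rw [abs_div, abs_of_pos hl0, Real.div_rpow (abs_nonneg _) hl0.le, div_eq_inv_mul]
  gcongr
  simpa using Real.rpow_le_rpow_of_exponent_le hl (ha x hx)

theorem varModular_lt_top_of_div {n : ℕ} {Ω : Set (EuclideanSpace ℝ (Fin n))} (hΩo : IsOpen Ω)
    {a : EuclideanSpace ℝ (Fin n) → ℝ} {R l : ℝ} (ha : ∀ x ∈ Ω, 0 ≤ a x) (haR : ∀ x ∈ Ω, a x ≤ R)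
    (hl : 0 < l) {u : EuclideanSpace ℝ (Fin n) → ℝ} (h : varModular Ω a (fun x => u x / l) < ⊤) :
    varModular Ω a u < ⊤ := by
  refine lt_of_le_of_lt (b := ENNReal.ofReal (1 + l ^ R) * varModular Ω a (fun x => u x / l)) ?_
    (ENNReal.mul_lt_top ENNReal.ofReal_lt_top h)
  rw [varModular, varModular, ← lintegral_const_mul' _ _ ENNReal.ofReal_ne_top]
  refine setLIntegral_mono' hΩo.measurableSet fun x hx => ?_
  rw [← ENNReal.ofReal_mul (by positivity)]
  refine ENNReal.ofReal_le_ofReal ?_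
  have h1 : |u x| = l * |u x / l| := by rw [abs_div, abs_of_pos hl]; field_simp
  nth_rewrite 1 [h1]
  rw [Real.mul_rpow hl.le (abs_nonneg _)]
  gcongr
  exact rpow_le_one_add_rpow hl.le (ha x hx) (haR x hx)

theorem varModular_div_max_le_one {n : ℕ} {Ω : Set (EuclideanSpace ℝ (Fin n))} (hΩo : IsOpen Ω)
    {a : EuclideanSpace ℝ (Fin n) → ℝ} (ha : ∀ x ∈ Ω, 1 ≤ a x) {u : EuclideanSpace ℝ (Fin n) → ℝ}
    {K : ℝ} (hu : varModular Ω a u ≤ ENNReal.ofReal K) :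
    varModular Ω a (fun x => u x / max 1 K) ≤ 1 := by
  have h1 : 0 < max 1 K := lt_of_lt_of_le one_pos (le_max_left _ _)
  calc _ ≤ ENNReal.ofReal (max 1 K)⁻¹ * varModular Ω a u :=
        varModular_div_le hΩo ha u (le_max_left _ _)
    _ ≤ ENNReal.ofReal (max 1 K)⁻¹ * ENNReal.ofReal (max 1 K) := by
        gcongr
        exact hu.trans (ENNReal.ofReal_le_ofReal (le_max_right _ _))
    _ = 1 := by
        rw [← ENNReal.ofReal_mul (by positivity), inv_mul_cancel₀ h1.ne', ENNReal.ofReal_one]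

theorem statement3
    {n : ℕ} (hn : 1 ≤ n)
    (Ω : Set (EuclideanSpace ℝ (Fin n))) (hΩo : IsOpen Ω) (hΩb : Bornology.IsBounded Ω)
    (hΩs : HasSmoothBoundary Ω)
    (p : EuclideanSpace ℝ (Fin n) → ℝ) (hpc : ContinuousOn p (closure Ω))
    (pm pM : ℝ) (hpm : IsLeast (p '' closure Ω) pm) (hpM : IsGreatest (p '' closure Ω) pM)
    (hpm2 : 2 < pm)
    (M : ℝ) (hM : 0 < M)
    (hplog : ∀ x ∈ Ω, ∀ y ∈ Ω, dist x y < 1 / 2 → |p x - p y| ≤ M / |Real.log (dist x y)|)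
    (q : EuclideanSpace ℝ (Fin n) → EuclideanSpace ℝ (Fin n) → ℝ)
    (hqc : ContinuousOn (Function.uncurry q) (closure Ω ×ˢ closure Ω))
    (hqsym : ∀ x ∈ closure Ω, ∀ y ∈ closure Ω, q x y = q y x)
    (hqtr : ∀ x ∈ Ω, ∀ y ∈ Ω, ∀ z ∈ Ω, x - z ∈ closure Ω → y - z ∈ closure Ω →
      q (x - z) (y - z) = q x y)
    (qm qM : ℝ) (hqm : IsLeast (Function.uncurry q '' (closure Ω ×ˢ closure Ω)) qm)
    (hqM : IsGreatest (Function.uncurry q '' (closure Ω ×ˢ closure Ω)) qM)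
    (hqm1 : 1 < qm) (hqMpm : qM < pm)
    (s : EuclideanSpace ℝ (Fin n) → EuclideanSpace ℝ (Fin n) → ℝ)
    (hsc : Continuous (Function.uncurry s))
    (hssym : ∀ x y, s x y = s y x)
    (hs01 : ∀ x y, 0 < s x y ∧ s x y < 1)
    (sm : ℝ) (hsm : IsLeast (Function.uncurry s '' (closure Ω ×ˢ closure Ω)) sm)
    (hnsq : ∀ x ∈ closure Ω, ∀ y ∈ closure Ω, sm * q x y < (n : ℝ))
    (hpq : ∀ x ∈ closure Ω, q x x < p x)
    (r : EuclideanSpace ℝ (Fin n) → ℝ) (hrc : ContinuousOn r (closure Ω))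
    (hr1 : ∀ x ∈ closure Ω, 1 < r x)
    (hrsub : ∀ x ∈ closure Ω, r x < (n : ℝ) * q x x / ((n : ℝ) - sm * q x x)) :
    ∃ C : ℝ, 0 < C ∧ ∀ v : EuclideanSpace ℝ (Fin n) → ℝ, MemH0 Ω p q s v →
      MemVarLp Ω r v ∧
        luxNorm Ω r v ≤ ENNReal.ofReal C * (luxNorm Ω p v + gagliardoSeminorm Ω q s v) := by
  have hK : IsCompact (closure Ω) := hΩb.isCompact_closure
  have hne : Ω.Nonempty := by
    obtain ⟨x, hx, -⟩ := hpm.1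
    exact closure_nonempty_iff.1 ⟨x, hx⟩
  have hσ : 0 < sm := by
    obtain ⟨⟨x, y⟩, -, hxy⟩ := hsm.1
    rw [← hxy]
    exact (hs01 x y).1
  have hp1 : ∀ x ∈ Ω, 1 ≤ p x := fun x hx => by
    linarith [hpm.2 (mem_image_of_mem p (subset_closure hx))]
  have hq1 : ∀ x ∈ closure Ω, ∀ y ∈ closure Ω, 1 < q x y := fun x hx y hy =>
    hqm1.trans_le (hqm.2 ⟨(x, y), ⟨hx, hy⟩, rfl⟩)
  have hq0 : ∀ x ∈ Ω, ∀ y ∈ Ω, 0 ≤ q x y := fun x hx y hy =>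
    (zero_le_one.trans_lt (hq1 x (subset_closure hx) y (subset_closure hy))).le
  have hs : ∀ x ∈ Ω, ∀ y ∈ Ω, sm ≤ s x y := fun x hx y hy =>
    hsm.2 ⟨(x, y), ⟨subset_closure hx, subset_closure hy⟩, rfl⟩
  have hr1' : ∀ x ∈ Ω, 1 ≤ r x := fun x hx => (hr1 x (subset_closure hx)).le
  obtain ⟨c, hc, ρ₁, hρ₁, hdens⟩ := hΩs.exists_measure_density hΩo hΩb
  obtain ⟨Q, b, β, R, ρ₂, hρ₂, hexp⟩ := exists_subcriticalExponents hn hne hK hσ hqc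
    (fun x hx => hq1 x hx x hx) (fun x hx => hnsq x hx x hx) hrc hr1 hrsub
  set ρ₀ := min (min ρ₁ ρ₂) 1
  have hρ₀ : 0 < ρ₀ := lt_min (lt_min hρ₁ hρ₂) one_pos
  have hρ₀₁ : ρ₀ ≤ ρ₁ := (min_le_left _ _).trans (min_le_left _ _)
  have hρ₀₂ : ρ₀ ≤ ρ₂ := (min_le_left _ _).trans (min_le_right _ _)
  have hexp₀ := hexp.mono_scale hρ₀₂
  set V := (volume Ω).toReal
  have hVΩ : volume Ω = ENNReal.ofReal V :=
    (ENNReal.ofReal_toReal hΩb.measure_lt_top.ne).symm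
  set K := subcriticalModularBound n c ρ₀ V R β
  have hC : 0 < max 1 K := lt_of_lt_of_le one_pos (le_max_left _ _)
  refine ⟨max 1 K, hC, fun v hv => ?_⟩
  obtain ⟨-, -, ⟨hvmΩ, hvp⟩, hvg⟩ := hv
  have hscaled : ∀ l₁ l₂ : ℝ, 0 < l₁ → varModular Ω p (fun x => v x / l₁) ≤ 1 → 0 < l₂ →
      gagliardoModular Ω q s (fun x => v x / l₂) < 1 →
      varModular Ω r (fun x => v x / (l₁ + l₂)) ≤ ENNReal.ofReal K := by
    intro l₁ l₂ hl₁ h₁ hl₂ h₂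
    have hl : 0 < l₁ + l₂ := by positivity
    refine varModular_le_subcriticalModularBound (p := p) hΩo hexp₀ (hvmΩ.div_const _)
      ((hpc.mono subset_closure).aemeasurable hΩo.measurableSet)
      ((hrc.mono subset_closure).aemeasurable hΩo.measurableSet) hc hσ hρ₀ (min_le_right _ _)
      ENNReal.toReal_nonneg hVΩ (fun x hx ρ hρ hρρ => hdens x hx ρ hρ (hρρ.trans hρ₀₁)) hs hp1 hq0
      ((varModular_mono hΩo (fun x hx => zero_le_one.trans (hp1 x hx)) fun x => ?_).trans h₁)
      ((gagliardoModular_mono hΩo hq0 fun x y => ?_).trans h₂.le)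
    · rw [abs_div, abs_div, abs_of_pos hl, abs_of_pos hl₁]
      gcongr
      linarith
    · rw [← sub_div, ← sub_div, abs_div, abs_div, abs_of_pos hl, abs_of_pos hl₂]
      gcongr
      linarith
  refine ⟨⟨hvmΩ, ?_⟩, ?_⟩
  · obtain ⟨_, ⟨l₂, ⟨hl₂, h₂⟩, rfl⟩, -⟩ := sInf_lt_iff.1 hvg
    have h₁ := varModular_div_max_le_one hΩo hp1 (ENNReal.ofReal_toReal hvp.ne).ge
    have hl₁ : 0 < max 1 (varModular Ω p v).toReal := lt_of_lt_of_le one_pos (le_max_left _ _)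
    exact varModular_lt_top_of_div hΩo hexp.r_nonneg hexp.r_le (add_pos hl₁ hl₂)
      ((hscaled _ l₂ hl₁ h₁ hl₂ h₂).trans_lt ENNReal.ofReal_lt_top)
  · have hC0 : ENNReal.ofReal (max 1 K) ≠ 0 := by simp
    rw [← ENNReal.div_le_iff' hC0 ENNReal.ofReal_ne_top, luxNorm.eq_1 Ω p, gagliardoSeminorm,
      ENNReal.sInf_add]
    refine le_iInf₂ ?_
    rintro _ ⟨l₁, ⟨hl₁, h₁⟩, rfl⟩
    rw [ENNReal.add_sInf]
    refine le_iInf₂ ?_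
    rintro _ ⟨l₂, ⟨hl₂, h₂⟩, rfl⟩
    rw [ENNReal.div_le_iff' hC0 ENNReal.ofReal_ne_top, ← ENNReal.ofReal_add hl₁.le hl₂.le,
      ← ENNReal.ofReal_mul hC.le]
    have hmod := varModular_div_max_le_one hΩo hr1' (hscaled l₁ l₂ hl₁ h₁ hl₂ h₂)
    simp only [div_div, mul_comm (l₁ + l₂)] at hmod
    exact sInf_le ⟨_, ⟨by positivity, hmod⟩, rfl⟩
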